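/- Finite self-dual Ramsey theorem (Solecki): for all positive integers K, l, M there exists N such that for every l-coloring of the set F_{N,K} of connections from N to K, there exists (s₀,j₀) ∈ F_{N,M} such that { (s ∘ s₀, j₀ ∘ j) : (s,j) ∈ F_{M,K} } is monochromatic. -/

import Mathlib

def IsRigidSurj (L K : ℕ) (t : Fin L → Fin K) : Prop :=
  Function.Surjective t ∧
    ∀ n : ℕ, n ≤ L → ∃ m : ℕ, m ≤ K ∧
      ∀ x : Fin K, ((x : ℕ) < m ↔ ∃ y : Fin L, (y : ℕ) < n ∧ t y = x)

def IsConnection (L K : ℕ) (t : Fin L → Fin K) (i : Fin K → Fin L) : Prop :=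
  IsRigidSurj L K t ∧ (∀ x, t (i x) = x) ∧
    ∀ (x : Fin K) (y : Fin L), y ≤ i x → t y ≤ x

namespace GR

/-- `e` is the first occurrence of `k` in `s`, and all earlier values are smaller. -/
def First (s : ℕ → ℕ) (k e : ℕ) : Prop := s e = k ∧ ∀ i < e, s i < k

/-- rigid surjections of the natural numbers -/
def Rig (s : ℕ → ℕ) : Prop := ∀ k, ∃ e, First s k e

/-- a colouring which only depends on the part of the word before the first `K` -/
def Loc {κ : Type} (K : ℕ) (c : (ℕ → ℕ) → κ) : Prop :=
  ∀ s s' e, First s K e → First s' K e → (∀ i < e, s i = s' i) → c s = c s'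

theorem First.comp {s w : ℕ → ℕ} {k e e' : ℕ} (h : First s k e) (h' : First w e e') :
    First (s ∘ w) k e' := by
  refine ⟨by simp [h'.1, h.1], fun i hi => h.2 _ (h'.2 i hi)⟩

theorem First.lt {s : ℕ → ℕ} {k k' e e' : ℕ} (h : First s k e) (h' : First s k' e')
    (hk : k < k') : e < e' := by
  by_contra hc
  rcases Nat.lt_or_ge e' e with h1 | h1
  · have := h.2 _ h1
    rw [h'.1] at this; omega
  · have : e = e' := by omega
    subst this
    have := h.1; have := h'.1; omega

theorem First.unique {s : ℕ → ℕ} {k e e' : ℕ} (h : First s k e) (h' : First s k e') : e = e' := by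
  rcases Nat.lt_trichotomy e e' with h1 | h1 | h1
  · have := h'.2 _ h1; have := h.1; omega
  · exact h1
  · have := h.2 _ h1; have := h'.1; omega

theorem First.le {s : ℕ → ℕ} {k k' e e' : ℕ} (h : First s k e) (h' : First s k' e')
    (hk : k ≤ k') : e ≤ e' := by
  rcases Nat.lt_or_eq_of_le hk with h1 | h1
  · exact (h.lt h' h1).le
  · subst h1; exact (h.unique h').le

theorem First.congr {s s' : ℕ → ℕ} {k e : ℕ} (h : First s k e) (h' : ∀ i ≤ e, s' i = s i) :
    First s' k e :=
  ⟨by rw [h' e le_rfl, h.1], fun i hi => by rw [h' i hi.le]; exact h.2 i hi⟩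

theorem rig_id : Rig id := fun k => ⟨k, rfl, fun _ hi => hi⟩

theorem first_id (k : ℕ) : First id k k := ⟨rfl, fun _ hi => hi⟩

theorem Rig.comp {s w : ℕ → ℕ} (h : Rig s) (h' : Rig w) : Rig (s ∘ w) := by
  intro k
  obtain ⟨e, he⟩ := h k
  obtain ⟨e', he'⟩ := h' e
  exact ⟨e', he.comp he'⟩

theorem Loc.comp {κ : Type} {K : ℕ} {c : (ℕ → ℕ) → κ} (h : Loc K c) {w : ℕ → ℕ} (hw : Rig w) :
    Loc K (fun u => c (u ∘ w)) := by
  intro s s' e h1 h2 h3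
  obtain ⟨e', he'⟩ := hw e
  exact h _ _ e' (h1.comp he') (h2.comp he') (fun i hi => h3 _ (he'.2 i hi))

theorem region (κ : Type) [Finite κ] (j N : ℕ) (hj : j < N) :
    ∃ n, ∀ c : (ℕ → ℕ) → κ, Loc (j+1) c → ∃ w, Rig w ∧ (∀ i < N, w i = i) ∧
      First w (N+1) (N+n) ∧
      ∀ v v' : ℕ → ℕ, First v (j+1) (N+1) → First v' (j+1) (N+1) → (∀ i < N, v i = v' i) →
        (∀ i ≤ j, v i = i) → c (v ∘ w) = c (v' ∘ w) := by
  obtain ⟨n, hn⟩ := Combinatorics.Subspace.exists_mono_in_high_dimension_fin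
    (Fin (j+1)) ((Fin N → Fin (j+1)) → κ) Unit
  refine ⟨n, fun c hc => ?_⟩
  obtain ⟨l, col, hl⟩ := hn (fun y q => c (fun i => if h : i < N then (q ⟨i, h⟩ : ℕ) else
    if h' : i - N < n then (y ⟨i - N, h'⟩ : ℕ) else j + 1 + (i - N - n)))
  let w : ℕ → ℕ := fun i => if i < N then i else
    if h' : i - N < n then (match l.idxFun ⟨i - N, h'⟩ with
      | Sum.inl a => (a : ℕ)
      | Sum.inr _ => N) else N + 1 + (i - N - n)
  have w1 : ∀ i < N, w i = i := fun i hi => by simp [w, hi]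
  have w2 : ∀ i, w (N + n + i) = N + 1 + i := fun i => by
    have h1 : ¬ (N + n + i < N) := by omega
    have h2 : ¬ (N + n + i - N < n) := by omega
    simp only [w, h1, h2, if_false, dif_neg, not_false_eq_true]
    omega
  have w3 : ∀ i < N + n, w i ≤ N := fun i hi => by
    by_cases h : i < N
    · rw [w1 i h]; omega
    · have h2 : i - N < n := by omega
      simp only [w, h, if_false, h2, dif_pos]
      rcases l.idxFun ⟨i - N, h2⟩ with a | a
      · have := a.2; simp only; omega
      · simp
  have wN : ∀ k, First w (N + 1 + k) (N + n + k) := fun k => by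
    refine ⟨w2 k, fun i hi => ?_⟩
    by_cases h : i < N + n
    · have := w3 i h; omega
    · obtain ⟨t, rfl⟩ := Nat.exists_eq_add_of_le (not_lt.1 h)
      rw [w2]; omega
  refine ⟨w, ?_, w1, wN 0, ?_⟩
  · intro k
    rcases Nat.lt_trichotomy k N with h | h | h
    · exact ⟨k, w1 k h, fun i hi => by rw [w1 i (by omega)]; exact hi⟩
    · subst h
      have hex : ∃ i, w i = k := by
        obtain ⟨i, hi⟩ := l.proper ()
        refine ⟨k + i, ?_⟩
        have h1 : ¬ (k + i.1 < k) := by omega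
        have h2 : k + i.1 - k < n := by omega
        have h3 : (⟨k + i.1 - k, h2⟩ : Fin n) = i := by ext; simp
        simp only [w, h1, if_false, h2, dif_pos]
        rw [h3, hi]
      classical
      refine ⟨Nat.find hex, Nat.find_spec hex, fun i hi => ?_⟩
      have h1 := Nat.find_min hex hi
      have h2 : Nat.find hex < k + n := by
        by_contra hc
        obtain ⟨t, ht⟩ := Nat.exists_eq_add_of_le (not_lt.1 hc)
        have := Nat.find_spec hex
        rw [ht, w2] at this; omega
      have := w3 i (by omega)
      omega
    · obtain ⟨t, rfl⟩ := Nat.exists_eq_add_of_le (Nat.succ_le_of_lt h)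
      exact ⟨_, wN t⟩
  · have key : ∀ v : ℕ → ℕ, First v (j+1) (N+1) → (∀ i ≤ j, v i = i) →
        c (v ∘ w) = col (fun i => Fin.ofNat (j+1) (v i)) := by
      intro v hv hid
      rw [← hl (fun _ => Fin.ofNat (j+1) (v N))]
      have hlt : ∀ i ≤ N, v i % (j+1) = v i := fun i hi => Nat.mod_eq_of_lt (hv.2 i (by omega))
      have hag : ∀ i < N + n, (v ∘ w) i = (fun i => if h : i < N then ((Fin.ofNat (j+1) (v i) : Fin (j+1)) : ℕ) else
          if h' : i - N < n then (l (fun _ => Fin.ofNat (j+1) (v N)) ⟨i - N, h'⟩ : ℕ)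
            else j + 1 + (i - N - n)) i := by
        intro i hi
        by_cases h : i < N
        · simp only [Function.comp, w1 i h, h, dif_pos, Fin.ofNat]
          rw [hlt i h.le]
        · have h2 : i - N < n := by omega
          simp only [Function.comp, h, dif_neg, not_false_eq_true, h2, dif_pos, w, if_false]
          rw [Combinatorics.Subspace.apply_def]
          rcases l.idxFun ⟨i - N, h2⟩ with a | a
          · simpa using hid a.1 (by omega)
          · simpa using (hlt N le_rfl).symm
      have hF := hv.comp (wN 0)
      refine hc _ _ _ hF ?_ hag
      refine ⟨?_, fun i hi => ?_⟩
      · have h1 : ¬ (N + n < N) := by omega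
        simp
      · rw [← hag i hi]; exact hF.2 i hi
    intro v v' hv hv' hvv hid
    rw [key v hv hid, key v' hv' (fun i hi => by rw [← hvv i (by omega)]; exact hid i hi)]
    congr 1
    funext i
    rw [hvv i i.2]

/-- The colour depends only on the end position. -/
theorem stageE (j m : ℕ) : ∀ (κ : Type) [Finite κ], ∃ N, j < N ∧
    ∀ c : (ℕ → ℕ) → κ, Loc (j+1) c → ∃ w, Rig w ∧ (∀ i ≤ j, w i = i) ∧
      First w (j+1+m) N ∧
      ∀ (u u' : ℕ → ℕ) (e : ℕ), (∀ i ≤ j, u i = i) → (∀ i ≤ j, u' i = i) →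
        First u (j+1) e → First u' (j+1) e → e ≤ j+1+m → c (u ∘ w) = c (u' ∘ w) := by
  induction m with
  | zero =>
    intro κ _
    refine ⟨j+1, by omega, fun c hc => ⟨id, rig_id, fun _ _ => rfl, first_id _, ?_⟩⟩
    intro u u' e hu hu' h1 h2 he
    exact hc _ _ e h1 h2 (fun i hi => by
      have : i ≤ j := by omega
      simp [hu i this, hu' i this])
  | succ m ih =>
    intro κ _
    obtain ⟨N, hjN, hN⟩ := ih (κ × κ)
    obtain ⟨n, hn⟩ := region κ j N hjN
    refine ⟨N + n, by omega, fun c hc => ?_⟩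
    obtain ⟨w1, hw1, hw1id, hw1F, hw1c⟩ := hn c hc
    have hc1 : Loc (j+1) (fun u => c (u ∘ w1)) := hc.comp hw1
    classical
    let plus : (ℕ → ℕ) → ℕ → ℕ := fun u i => if i < N then u i else if i = N then 0 else
      j + 1 + (i - N - 1)
    obtain ⟨w2, hw2, hw2id, hw2F, hw2c⟩ := hN
      (fun u => (c (u ∘ w1), if First u (j+1) N then c (plus u ∘ w1) else c (u ∘ w1))) (by
        intro s s' e h1 h2 h3
        have e1 := hc1 s s' e h1 h2 h3
        simp only at e1
        by_cases hs : First s (j+1) N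
        · have : e = N := h1.unique hs
          subst this
          have : plus s = plus s' := by
            funext i
            by_cases hi : i < e
            · simp [plus, hi, h3 i hi]
            · simp [plus, hi]
          simp only [h1, h2, if_true, e1, this]
        · have hs' : ¬ First s' (j+1) N := fun h => by
            have : e = N := h2.unique h
            subst this
            exact hs h1
          simp only [hs, hs', if_false, e1])
    let w3 : ℕ → ℕ := fun i => if i < N then w2 i else j + 1 + m + (i - N)
    have w3a : ∀ i < N, w3 i = w2 i := fun i hi => by simp [w3, hi]
    have w3b : ∀ k, w3 (N + k) = j + 1 + m + k := fun k => by simp [w3]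
    have w3F : ∀ k, First w3 (j + 1 + m + k) (N + k) := fun k => by
      refine ⟨w3b k, fun i hi => ?_⟩
      by_cases h : i < N
      · rw [w3a i h]; have := hw2F.2 i h; omega
      · obtain ⟨t, rfl⟩ := Nat.exists_eq_add_of_le (not_lt.1 h)
        rw [w3b]; omega
    have w3G : ∀ k e, k ≤ j + 1 + m → First w2 k e → First w3 k e := by
      intro k e hk h
      have hle : e ≤ N := h.le hw2F hk
      refine h.congr fun i hi => ?_
      by_cases h' : i < N
      · exact w3a i h'
      · have : i = N := by omega
        subst this
        rw [hw2F.1]; simpa using w3b 0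
    have hw3 : Rig w3 := by
      intro k
      by_cases hk : k ≤ j + 1 + m
      · obtain ⟨e, he⟩ := hw2 k
        exact ⟨e, w3G k e hk he⟩
      · obtain ⟨t, rfl⟩ := Nat.exists_eq_add_of_le (not_le.1 hk).le
        exact ⟨_, w3F t⟩
    have hw3id : ∀ i ≤ j, w3 i = i := fun i hi => by
      rw [w3a i (by omega)]; exact hw2id i hi
    refine ⟨w3 ∘ w1, hw3.comp hw1, fun i hi => ?_, (w3F 1).comp hw1F, ?_⟩
    · simp [hw1id i (by omega), hw3id i hi]
    · intro u u' e hu hu' h1 h2 he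
      by_cases hem : e ≤ j + 1 + m
      · have key : ∀ u, First u (j+1) e → c (u ∘ w3 ∘ w1) = c ((u ∘ w2) ∘ w1) := by
          intro u h
          obtain ⟨e2, he2⟩ := hw2 e
          refine hc1 (u ∘ w3) (u ∘ w2) e2 (h.comp (w3G _ _ hem he2)) (h.comp he2) fun i hi => ?_
          have hle : e2 ≤ N := he2.le hw2F hem
          simp [w3a i (by omega)]
        rw [key u h1, key u' h2]
        exact congrArg Prod.fst (hw2c u u' e hu hu' h1 h2 hem)
      · have hee : e = j + 1 + m + 1 := by omega
        subst hee
        let tl : (ℕ → ℕ) → ℕ → ℕ := fun u i => if i < j + 1 + m then u i else i - m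
        have tlF : ∀ u, First u (j+1) (j+1+m+1) → First (tl u) (j+1) (j+1+m) := by
          intro u h
          refine ⟨by simp [tl], fun i hi => ?_⟩
          simp only [tl, hi, if_true]
          exact h.2 i (by omega)
        have tlid : ∀ u : ℕ → ℕ, (∀ i ≤ j, u i = i) → ∀ i ≤ j, tl u i = i := by
          intro u h i hi
          have : i < j + 1 + m := by omega
          simp only [tl, this, if_true]
          exact h i hi
        have key : ∀ u : ℕ → ℕ, (∀ i ≤ j, u i = i) → First u (j+1) (j+1+m+1) →
            c (u ∘ w3 ∘ w1) = c (plus (tl u ∘ w2) ∘ w1) := by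
          intro u hid h
          have hag : ∀ i < N, (u ∘ w3) i = plus (tl u ∘ w2) i := by
            intro i hi
            have := hw2F.2 i hi
            simp [plus, tl, hi, w3a i hi, this]
          have hF := h.comp (w3F 1)
          refine hw1c (u ∘ w3) _ hF ?_ hag ?_
          · refine ⟨by simp [plus], fun i hi => ?_⟩
            by_cases h' : i < N
            · rw [← hag i h']; exact hF.2 i hi
            · have : i = N := by omega
              simp [plus, this]
          · intro i hi
            simp [hw3id i hi, hid i hi]
        rw [key u hu h1, key u' hu' h2]
        have := congrArg Prod.snd (hw2c (tl u) (tl u') _ (tlid u hu) (tlid u' hu')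
          (tlF u h1) (tlF u' h2) le_rfl)
        simpa only [(tlF u h1).comp hw2F, (tlF u' h2).comp hw2F, if_true] using this

/-- Pigeonhole on the end position. -/
theorem stageH (j M : ℕ) (κ : Type) [Finite κ] : ∃ N,
    ∀ c : (ℕ → ℕ) → κ, Loc (j+1) c → ∃ w, Rig w ∧ (∀ i ≤ j, w i = i) ∧
      (∃ e ≤ N, First w (j+1+M) e) ∧
      ∀ (u u' : ℕ → ℕ) (e e' : ℕ), (∀ i ≤ j, u i = i) → (∀ i ≤ j, u' i = i) →
        First u (j+1) e → First u' (j+1) e' → e ≤ j+1+M → e' ≤ j+1+M →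
          c (u ∘ w) = c (u' ∘ w) := by
  classical
  have := Fintype.ofFinite κ
  obtain ⟨N, hjN, hN⟩ := stageE j (Fintype.card κ * (M+1)) κ
  set m := Fintype.card κ * (M+1) with hm
  refine ⟨N, fun c hc => ?_⟩
  obtain ⟨w, hw, hwid, hwF, hwc⟩ := hN c hc
  -- the canonical word ending at `e`
  let can : ℕ → ℕ → ℕ := fun e i => if i ≤ j then i else if i < e then 0 else j + 1 + (i - e)
  have canid : ∀ e, ∀ i ≤ j, can e i = i := fun e i hi => by simp [can, hi]
  have canF : ∀ e, j + 1 ≤ e → First (can e) (j+1) e := by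
    intro e he
    refine ⟨?_, fun i hi => ?_⟩
    · have : ¬ e ≤ j := by omega
      simp [can, this]
    · by_cases h : i ≤ j
      · simp only [can, h, if_true]; omega
      · simp [can, h, hi]
  obtain ⟨k, hk⟩ : ∃ k : κ, M + 1 ≤
      ((Finset.Icc (j+1) (j+1+m)).filter (fun e => c (can e ∘ w) = k)).card := by
    obtain ⟨k, -, hk⟩ := Finset.exists_lt_card_fiber_of_mul_lt_card_of_maps_to
      (s := Finset.Icc (j+1) (j+1+m)) (t := (Finset.univ : Finset κ))
      (f := fun e => c (can e ∘ w)) (n := M+1) (fun _ _ => Finset.mem_univ _) (by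
        simp only [Finset.card_univ, Nat.card_Icc]; omega)
    exact ⟨k, hk.le⟩
  set S := (Finset.Icc (j+1) (j+1+m)).filter (fun e => c (can e ∘ w) = k) with hS
  let P : ℕ → Prop := fun i => i ∈ S ∨ j + 1 + m < i
  have hSm : ∀ i ∈ S, j + 1 ≤ i ∧ i ≤ j + 1 + m ∧ c (can i ∘ w) = k := by
    intro i hi
    simp only [hS, Finset.mem_filter, Finset.mem_Icc] at hi
    tauto
  have hPj : ∀ i, P i → j < i := by
    rintro i (h | h)
    · have := hSm i h; omega
    · omega
  have hPinf : (setOf P).Infinite := by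
    refine Set.infinite_of_injective_forall_mem (f := fun i : ℕ => j + 1 + m + 1 + i) ?_ ?_
    · intro a b h; simpa using h
    · intro i; right; omega
  let w3 : ℕ → ℕ := fun i => if i ≤ j then i else if P i then j + 1 + Nat.count P i else 0
  have w3id : ∀ i ≤ j, w3 i = i := fun i hi => by simp [w3, hi]
  have w3F : ∀ t, First w3 (j+1+t) (Nat.nth P t) := by
    intro t
    have hP := Nat.nth_mem_of_infinite hPinf t
    have h1 : ¬ Nat.nth P t ≤ j := by have := hPj _ hP; omega
    refine ⟨?_, fun i hi => ?_⟩
    · simp only [w3, h1, if_false, hP, if_true, Nat.count_nth_of_infinite hPinf]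
    · by_cases h : i ≤ j
      · simp only [w3, h, if_true]; omega
      · by_cases h' : P i
        · simp only [w3, h, h', if_true, if_false]
          have : Nat.count P i < Nat.count P (Nat.nth P t) := Nat.count_strict_mono h' hi
          rw [Nat.count_nth_of_infinite hPinf] at this
          omega
        · simp only [w3, h, h', if_false]; omega
  have hw3 : Rig w3 := by
    intro t
    by_cases h : t ≤ j
    · exact ⟨t, w3id t h, fun i hi => by rw [w3id i (by omega)]; exact hi⟩
    · obtain ⟨r, rfl⟩ := Nat.exists_eq_add_of_le (Nat.succ_le_of_lt (not_le.1 h))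
      exact ⟨_, w3F r⟩
  have hcount : M < Nat.count P (j+1+m+1) := by
    rw [Nat.count_eq_card_filter_range]
    refine lt_of_lt_of_le (Nat.lt_of_succ_le hk) (Finset.card_le_card ?_)
    intro i hi
    have := hSm i hi
    simp only [Finset.mem_filter, Finset.mem_range]
    exact ⟨by omega, Or.inl hi⟩
  have hnthM : Nat.nth P M ≤ j + 1 + m := Nat.lt_succ_iff.1 (Nat.nth_lt_of_lt_count hcount)
  have hnth : ∀ t ≤ M, Nat.nth P t ∈ S := by
    intro t ht
    have h1 : Nat.nth P t ≤ Nat.nth P M := (Nat.nth_monotone hPinf) ht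
    rcases Nat.nth_mem_of_infinite hPinf t with h | h
    · exact h
    · omega
  have key : ∀ (u : ℕ → ℕ) (e : ℕ), (∀ i ≤ j, u i = i) → First u (j+1) e → e ≤ j+1+M →
      c (u ∘ w3 ∘ w) = k := by
    intro u e hid hF he
    have hje : j + 1 ≤ e := by
      by_contra hc
      have := hid e (by omega)
      have := hF.1
      omega
    obtain ⟨t, rfl⟩ := Nat.exists_eq_add_of_le hje
    have hmem := hSm _ (hnth t (by omega))
    rw [← hmem.2.2]
    refine hwc (u ∘ w3) _ (Nat.nth P t) ?_ (canid _) (hF.comp (w3F t)) (canF _ hmem.1) hmem.2.1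
    intro i hi
    simp [w3id i hi, hid i hi]
  refine ⟨w3 ∘ w, hw3.comp hw, fun i hi => by simp [hwid i hi, w3id i hi], ?_, ?_⟩
  · obtain ⟨e, he⟩ := hw (Nat.nth P M)
    exact ⟨e, he.le hwF hnthM, (w3F M).comp he⟩
  · intro u u' e e' h1 h2 h3 h4 h5 h6
    rw [key u e h1 h3 h5, key u' e' h2 h4 h6]

theorem stageL (K j M : ℕ) (κ : Type) [Finite κ] : ∃ N,
    ∀ c : (ℕ → ℕ) → κ, Loc (K+1) c → ∃ w, Rig w ∧ (∀ i ≤ j, w i = i) ∧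
      (∃ e ≤ N, First w M e) ∧
      ∀ (s s' : ℕ → ℕ) (e e' : ℕ), Rig s → Rig s' → First s K j → First s' K j →
        (∀ i < j, s i = s' i) → First s (K+1) e → First s' (K+1) e' → e ≤ M → e' ≤ M →
          c (s ∘ w) = c (s' ∘ w) := by
  obtain ⟨N, hN⟩ := stageH j M ((Fin j → Fin K) → κ)
  refine ⟨N, fun c hc => ?_⟩
  let p : (Fin j → Fin K) → ℕ → ℕ := fun q i => if h : i < j then (q ⟨i, h⟩ : ℕ) else K + (i - j)
  have pF : ∀ q, First (p q) (K+1) (j+1) := by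
    intro q
    refine ⟨by simp [p], fun i hi => ?_⟩
    by_cases h : i < j
    · simp only [p, h, dif_pos]; have := (q ⟨i, h⟩).2; omega
    · simp only [p, h, dif_neg, not_false_eq_true]; omega
  obtain ⟨w, hw, hwid, ⟨e0, he0, hwF⟩, hwc⟩ := hN (fun u q => c (p q ∘ u)) (by
    intro u u' e h1 h2 h3
    funext q
    exact hc _ _ e ((pF q).comp h1) ((pF q).comp h2) (fun i hi => by simp [h3 i hi]))
  have key : ∀ (s : ℕ → ℕ) (e : ℕ), Rig s → ∀ hF : First s K j, First s (K+1) e →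
      ∃ u, (∀ i ≤ j, u i = i) ∧ First u (j+1) e ∧
        c (s ∘ w) = c (p (fun i => ⟨s i, hF.2 i i.2⟩) ∘ (u ∘ w)) := by
    intro s e hs hF hFe
    have hje : j < e := hF.lt hFe (by omega)
    have hex : ∀ i, ∃ a, i < e → a ≤ j ∧ s a = s i := by
      intro i
      by_cases hi : i < e
      · have h1 := hFe.2 i hi
        obtain ⟨a, ha⟩ := hs (s i)
        exact ⟨a, fun _ => ⟨ha.le hF (by omega), ha.1⟩⟩
      · exact ⟨0, fun h => absurd h hi⟩
    choose f hf using hex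
    let u : ℕ → ℕ := fun i => if i ≤ j then i else if i < e then f i else j + 1 + (i - e)
    have uid : ∀ i ≤ j, u i = i := fun i hi => by simp [u, hi]
    have ulow : ∀ i < e, u i ≤ j ∧ s (u i) = s i := by
      intro i hi
      by_cases h : i ≤ j
      · rw [uid i h]; exact ⟨h, rfl⟩
      · simp only [u, h, hi, if_true, if_false]
        exact hf i hi
    have uF : First u (j+1) e := by
      refine ⟨?_, fun i hi => Nat.lt_succ_of_le (ulow i hi).1⟩
      have : ¬ e ≤ j := by omega
      simp [u, this]
    refine ⟨u, uid, uF, ?_⟩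
    refine hc.comp hw s (p (fun i => ⟨s i, hF.2 i i.2⟩) ∘ u) e hFe ((pF (fun i => ⟨s i, hF.2 i i.2⟩)).comp uF) fun i hi => ?_
    obtain ⟨h1, h2⟩ := ulow i hi
    rw [← h2]
    by_cases h : u i < j
    · simp [p, h]
    · have : u i = j := by omega
      simp [p, this, hF.1]
  refine ⟨w, hw, hwid, ?_, ?_⟩
  · obtain ⟨e, he⟩ := hw M
    exact ⟨e, (he.le hwF (by omega)).trans he0, he⟩
  · intro s s' e e' hs hs' h1 h2 h3 h4 h5 h6 h7
    obtain ⟨u, a1, a2, a3⟩ := key s e hs h1 h4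
    obtain ⟨u', b1, b2, b3⟩ := key s' e' hs' h2 h5
    have hq : (fun i : Fin j => (⟨s i, h1.2 i i.2⟩ : Fin K)) =
        fun i => ⟨s' i, h2.2 i i.2⟩ := by
      funext i
      ext
      exact h3 i i.2
    rw [a3, b3, hq]
    have hfin := congrFun (hwc u u' e e' a1 b1 a2 b2 (by omega) (by omega))
      (fun i => ⟨s' i, h2.2 i i.2⟩)
    exact hfin

/-- The colour depends only on the `K`-prefix. -/
theorem stageT (K : ℕ) (κ : Type) [Finite κ] (J : ℕ) : ∀ M, ∃ N,
    ∀ c : (ℕ → ℕ) → κ, Loc (K+1) c → ∃ w, Rig w ∧ (∃ e ≤ N, First w M e) ∧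
      ∀ (s s' : ℕ → ℕ) (j e e' : ℕ), Rig s → Rig s' → j < J → First s K j → First s' K j →
        (∀ i < j, s i = s' i) → First s (K+1) e → First s' (K+1) e' → e ≤ M → e' ≤ M →
          c (s ∘ w) = c (s' ∘ w) := by
  induction J with
  | zero =>
    intro M
    refine ⟨M, fun c hc => ⟨id, rig_id, ⟨M, le_rfl, first_id M⟩, ?_⟩⟩
    intro s s' j e e' _ _ h
    omega
  | succ J ih =>
    intro M
    obtain ⟨M1, hM1⟩ := stageL K J M κ
    obtain ⟨N, hN⟩ := ih M1
    refine ⟨N, fun c hc => ?_⟩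
    obtain ⟨w1, hw1, ⟨e1, he1, hw1F⟩, hw1c⟩ := hN c hc
    obtain ⟨w2, hw2, hw2id, ⟨e2, he2, hw2F⟩, hw2c⟩ := hM1 _ (hc.comp hw1)
    refine ⟨w2 ∘ w1, hw2.comp hw1, ?_, ?_⟩
    · obtain ⟨e, he⟩ := hw1 e2
      exact ⟨e, (he.le hw1F he2).trans he1, hw2F.comp he⟩
    · intro s s' j e e' hs hs' hj h1 h2 h3 h4 h5 h6 h7
      rcases Nat.lt_or_eq_of_le (Nat.lt_succ_iff.1 hj) with hlt | rfl
      · obtain ⟨f, hf⟩ := hw2 e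
        obtain ⟨f', hf'⟩ := hw2 e'
        have hid : First w2 j j :=
          ⟨hw2id j hlt.le, fun i hi => by rw [hw2id i (by omega)]; exact hi⟩
        exact hw1c (s ∘ w2) (s' ∘ w2) j f f' (hs.comp hw2) (hs'.comp hw2) hlt
          (h1.comp hid) (h2.comp hid)
          (fun i hi => by simp [hw2id i (by omega), h3 i hi])
          (h4.comp hf) (h5.comp hf') ((hf.le hw2F h6).trans he2) ((hf'.le hw2F h7).trans he2)
      · exact hw2c s s' e e' hs hs' h1 h2 h3 h4 h5 h6 h7

/-- The dual Ramsey theorem of Graham and Rothschild. -/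
theorem dualRamsey (κ : Type) [Finite κ] (K : ℕ) : ∀ M, ∃ N,
    ∀ c : (ℕ → ℕ) → κ, Loc K c → ∃ w, Rig w ∧ (∃ e ≤ N, First w M e) ∧
      ∀ (s s' : ℕ → ℕ) (e e' : ℕ), Rig s → Rig s' → First s K e → First s' K e' →
        e ≤ M → e' ≤ M → c (s ∘ w) = c (s' ∘ w) := by
  induction K with
  | zero =>
    intro M
    refine ⟨M, fun c hc => ⟨id, rig_id, ⟨M, le_rfl, first_id M⟩, ?_⟩⟩
    have h0 : ∀ s e, First s 0 e → e = 0 := by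
      intro s e h
      by_contra hc
      have := h.2 0 (by omega)
      omega
    intro s s' e e' _ _ h1 h2 _ _
    have := h0 s e h1
    have := h0 s' e' h2
    subst e; subst e'
    exact hc _ _ 0 h1 h2 (fun i hi => by omega)
  | succ K ih =>
    intro M
    obtain ⟨N1, hN1⟩ := ih M
    obtain ⟨N, hN⟩ := stageT K κ N1 N1
    refine ⟨N, fun c hc => ?_⟩
    obtain ⟨w, hw, ⟨e0, he0, hwF⟩, hwc⟩ := hN c hc
    classical
    let ext : (ℕ → ℕ) → ℕ → ℕ → ℕ := fun s a i => if i < a then s i else K + (i - a)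
    have extF : ∀ s a, First s K a → ∀ t, First (ext s a) (K+t) (a+t) := by
      intro s a h t
      refine ⟨by simp [ext], fun i hi => ?_⟩
      by_cases h' : i < a
      · simp only [ext, h', if_true]; have := h.2 i h'; omega
      · simp only [ext, h', if_false]; omega
    have extRig : ∀ s a, Rig s → First s K a → Rig (ext s a) := by
      intro s a hs h k
      by_cases hk : k < K
      · obtain ⟨e, he⟩ := hs k
        have := he.lt h hk
        refine ⟨e, he.congr fun i hi => ?_⟩
        have : i < a := by omega
        simp [ext, this]
      · obtain ⟨t, rfl⟩ := Nat.exists_eq_add_of_le (not_lt.1 hk)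
        exact ⟨_, extF s a h t⟩
    let c' : (ℕ → ℕ) → κ := fun s => if h : ∃ a, First s K a then c (ext s h.choose ∘ w)
      else c id
    have c'eq : ∀ s a, First s K a → c' s = c (ext s a ∘ w) := by
      intro s a h
      have hex : ∃ a, First s K a := ⟨a, h⟩
      have : hex.choose = a := hex.choose_spec.unique h
      simp only [c', hex, dif_pos, this]
    obtain ⟨v, hv, ⟨e1, he1, hvF⟩, hvc⟩ := hN1 c' (by
      intro s s' a h1 h2 h3
      rw [c'eq s a h1, c'eq s' a h2]
      congr 2
      funext i
      by_cases hi : i < a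
      · simp [ext, hi, h3 i hi]
      · simp [ext, hi])
    refine ⟨v ∘ w, hv.comp hw, ?_, ?_⟩
    · obtain ⟨e, he⟩ := hw e1
      exact ⟨e, (he.le hwF he1).trans he0, hvF.comp he⟩
    · have key : ∀ (s : ℕ → ℕ) (e : ℕ), Rig s → First s (K+1) e → e ≤ M →
          c (s ∘ v ∘ w) = c' (s ∘ v) := by
        intro s e hs h he
        obtain ⟨a, ha⟩ := (hs.comp hv) K
        obtain ⟨f, hf⟩ := hv e
        have hF := h.comp hf
        have hfN : f ≤ N1 := (hf.le hvF he).trans he1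
        have haf : a < f := ha.lt hF (by omega)
        rw [c'eq _ a ha]
        exact hwc (s ∘ v) _ a f (a+1) (hs.comp hv) (extRig _ _ (hs.comp hv) ha) (by omega) ha
          (extF _ _ ha 0) (fun i hi => by simp [ext, hi]) hF (extF _ _ ha 1) hfN (by omega)
      intro s s' e e' hs hs' h1 h2 h3 h4
      rw [key s e hs h1 h3, key s' e' hs' h2 h4]
      obtain ⟨a, ha⟩ := hs K
      obtain ⟨a', ha'⟩ := hs' K
      exact hvc s s' a a' hs hs' ha ha' ((ha.le h1 (by omega)).trans h3)
        ((ha'.le h2 (by omega)).trans h4)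

end GR

theorem rigidSurj_of_first {N M : ℕ} (s : Fin N → Fin M)
    (h : ∀ x, ∃ e, s e = x ∧ ∀ y < e, s y < x) : IsRigidSurj N M s := by
  refine ⟨fun x => (h x).imp fun e he => he.1, fun n => ?_⟩
  induction n with
  | zero => intro _; exact ⟨0, Nat.zero_le _, fun x => by simp⟩
  | succ n ih =>
    intro hn
    obtain ⟨m, hm, hx⟩ := ih (by omega)
    set z : Fin N := ⟨n, by omega⟩ with hz
    have hle : (s z : ℕ) ≤ m := by
      by_contra hc
      have hmM : m < M := by have := (s z).2; omega
      obtain ⟨e, he, he'⟩ := h ⟨m, hmM⟩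
      have hez : e < z := by
        by_contra hcc
        rcases Nat.lt_or_ge z e with h1 | h1
        · have := he' z h1
          rw [Fin.lt_def] at this
          simp only at this
          omega
        · have : e = z := by ext; rw [Fin.lt_def] at hcc; omega
          rw [this] at he
          rw [he] at hc
          simp at hc
      have := (hx ⟨m, hmM⟩).2 ⟨e, hez, he⟩
      simp at this
    have hstep : ∀ x : Fin M, (∃ y : Fin N, (y : ℕ) < n + 1 ∧ s y = x) ↔ ((x : ℕ) < m ∨ s z = x) := by
      intro x
      rw [hx x]
      constructor
      · rintro ⟨y, hy, hyx⟩
        rcases Nat.lt_or_eq_of_le (Nat.lt_succ_iff.1 hy) with h1 | h1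
        · exact Or.inl ⟨y, h1, hyx⟩
        · right
          have : y = z := by ext; exact h1
          rw [← this]; exact hyx
      · rintro (⟨y, hy, hyx⟩ | hh)
        · exact ⟨y, by omega, hyx⟩
        · exact ⟨z, by simp [hz], hh⟩
    rcases Nat.lt_or_eq_of_le hle with h1 | h1
    · refine ⟨m, hm, fun x => ?_⟩
      rw [hstep x]
      constructor
      · exact Or.inl
      · rintro (h2 | h2)
        · exact h2
        · rw [← h2]; exact h1
    · refine ⟨m + 1, by have := (s z).2; omega, fun x => ?_⟩
      rw [hstep x, Fin.ext_iff]
      omega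

theorem first_of_rigidSurj {N M : ℕ} {s : Fin N → Fin M} (h : IsRigidSurj N M s) (x : Fin M) :
    ∃ e, s e = x ∧ ∀ y < e, s y < x := by
  classical
  have hex : ∃ n : ℕ, ∃ hn : n < N, s ⟨n, hn⟩ = x := by
    obtain ⟨e, he⟩ := h.1 x
    exact ⟨e, e.2, he⟩
  obtain ⟨hn, hs⟩ := Nat.find_spec hex
  refine ⟨⟨Nat.find hex, hn⟩, hs, fun y hy => ?_⟩
  obtain ⟨m, hm, hx⟩ := h.2 (Nat.find hex) hn.le
  have h1 : ¬ (x : ℕ) < m := by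
    rw [hx x]
    rintro ⟨y, hy, hyx⟩
    exact Nat.find_min hex hy ⟨y.2, hyx⟩
  have h2 : (s y : ℕ) < m := (hx (s y)).2 ⟨y, hy, rfl⟩
  rw [Fin.lt_def]; omega

open GR in
/-- the infinite rigid surjection coding a connection -/
theorem exists_code {M K : ℕ} {s : Fin M → Fin K} {j : Fin K → Fin M} (h : IsConnection M K s j) :
    ∃ r : ℕ → ℕ, Rig r ∧ First r (2*K) (2*M) ∧
      (∀ x : Fin K, First r (2*x+1) (2*(j x)+1)) ∧
      ∀ i, ∀ hi : i / 2 < M, r i / 2 = s ⟨i / 2, hi⟩ := by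
  classical
  let r : ℕ → ℕ := fun i => if hi : i / 2 < M then
      2 * (s ⟨i/2, hi⟩ : ℕ) + (if i % 2 = 1 ∧ j (s ⟨i/2, hi⟩) = ⟨i/2, hi⟩ then 1 else 0)
    else 2 * K + (i - 2 * M)
  have rhalf : ∀ i, ∀ hi : i / 2 < M, r i / 2 = s ⟨i / 2, hi⟩ := by
    intro i hi
    simp only [r, hi, dif_pos]
    split_ifs <;> omega
  have rtop : ∀ t, First r (2*K+t) (2*M+t) := by
    intro t
    have h1 : ¬ (2*M+t)/2 < M := by omega
    refine ⟨by simp only [r, h1, dif_neg, not_false_eq_true]; omega, fun i hi => ?_⟩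
    by_cases h2 : i / 2 < M
    · have := rhalf i h2
      have := (s ⟨i/2, h2⟩).2
      omega
    · simp only [r, h2, dif_neg, not_false_eq_true]; omega
  have rodd : ∀ x : Fin K, First r (2*x+1) (2*(j x)+1) := by
    intro x
    have h0 : (2 * (j x : ℕ) + 1) / 2 = j x := by omega
    have h0' : (2 * (j x : ℕ) + 1) / 2 < M := by rw [h0]; exact (j x).2
    have h1 : (⟨(2 * (j x : ℕ) + 1) / 2, h0'⟩ : Fin M) = j x := by ext; exact h0
    refine ⟨?_, fun i hi => ?_⟩
    · simp only [r, h0', dif_pos]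
      rw [h1, h.2.1 x, if_pos ⟨by omega, rfl⟩]
    · have h2 : i / 2 < M := by have := (j x).2; omega
      have h3 : (s ⟨i/2, h2⟩ : ℕ) ≤ x := h.2.2 x ⟨i/2, h2⟩ (by rw [Fin.le_def]; simp only; omega)
      have h4 := rhalf i h2
      by_cases h5 : i % 2 = 1 ∧ j (s ⟨i/2, h2⟩) = ⟨i/2, h2⟩
      · have h6 : s ⟨i/2, h2⟩ ≠ x := by
          intro hh
          rw [hh] at h5
          have := congrArg Fin.val h5.2
          simp only at this
          omega
        have : (s ⟨i/2, h2⟩ : ℕ) ≠ x := fun hh => h6 (Fin.ext hh)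
        omega
      · simp only [r, h2, dif_pos, h5, if_false]; omega
  have reven : ∀ x : Fin K, ∃ e, First r (2*x) e := by
    intro x
    obtain ⟨e, he, he'⟩ := first_of_rigidSurj h.1 x
    have h0 : (2 * (e : ℕ)) / 2 = e := by omega
    have h0' : (2 * (e : ℕ)) / 2 < M := by rw [h0]; exact e.2
    have h1 : (⟨(2 * (e : ℕ)) / 2, h0'⟩ : Fin M) = e := by ext; exact h0
    refine ⟨2 * e, ?_, fun i hi => ?_⟩
    · simp only [r, h0', dif_pos]
      rw [h1, he, if_neg (by omega), Nat.add_zero]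
    · have h2 : i / 2 < M := by have := e.2; omega
      have h3 := he' ⟨i/2, h2⟩ (by rw [Fin.lt_def]; simp only; omega)
      rw [Fin.lt_def] at h3
      have := rhalf i h2
      omega
  refine ⟨r, ?_, rtop 0, rodd, rhalf⟩
  intro k
  by_cases hk : k < 2 * K
  · rcases Nat.even_or_odd' k with ⟨x, rfl | rfl⟩
    · exact reven ⟨x, by omega⟩
    · exact ⟨_, rodd ⟨x, by omega⟩⟩
  · obtain ⟨t, rfl⟩ := Nat.exists_eq_add_of_le (not_lt.1 hk)
    exact ⟨_, rtop t⟩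

/-- `p` is the connection decoded from `r`. -/
def Decodes (N K : ℕ) (r : ℕ → ℕ) (p : (Fin N → Fin K) × (Fin K → Fin N)) : Prop :=
  ∃ e, GR.First r (2*K) e ∧ (∀ y : Fin N, (p.1 y : ℕ) = r (if (y : ℕ) < e then y else 0) / 2) ∧
    ∀ x : Fin K, GR.First r (2*x+1) (p.2 x)

theorem Decodes.unique {N K : ℕ} {r : ℕ → ℕ} {p q : (Fin N → Fin K) × (Fin K → Fin N)}
    (h : Decodes N K r p) (h' : Decodes N K r q) : p = q := by
  obtain ⟨e, h1, h2, h3⟩ := h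
  obtain ⟨e', h1', h2', h3'⟩ := h'
  have := h1.unique h1'
  subst this
  refine Prod.ext ?_ ?_
  · funext y; ext; rw [h2, h2']
  · funext x; ext; exact (h3 x).unique (h3' x)

theorem Decodes.congr {N K : ℕ} (hK : 0 < K) {r r' : ℕ → ℕ}
    {p : (Fin N → Fin K) × (Fin K → Fin N)} {e : ℕ}
    (h : Decodes N K r p) (h1 : GR.First r (2*K) e) (h1' : GR.First r' (2*K) e)
    (hr : ∀ i < e, r i = r' i) : Decodes N K r' p := by
  obtain ⟨f, g1, g2, g3⟩ := h
  have := h1.unique g1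
  subst this
  have he : 0 < e := lt_of_le_of_lt (Nat.zero_le _) ((g3 ⟨0, hK⟩).lt h1 (by simp only; omega))
  refine ⟨e, h1', fun y => ?_, fun x => ?_⟩
  · rw [g2, hr]
    split_ifs <;> assumption
  · have := (g3 x).lt h1 (by have := x.2; omega)
    exact (g3 x).congr fun i hi => (hr i (by omega)).symm

/-- Solecki's finite self-dual Ramsey theorem: for all positive
K, l, M there is N such that every l-coloring of F_{N,K} is monochromatic on
{ (s,j)·(s₀,j₀) : (s,j) ∈ F_{M,K} } for some connection (s₀,j₀) ∈ F_{N,M}. -/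
theorem finite_self_dual_ramsey (K l M : ℕ) (hK : 0 < K) (hl : 0 < l) (hM : 0 < M) :
    ∃ N : ℕ,
      ∀ g : { p : (Fin N → Fin K) × (Fin K → Fin N) //
                IsConnection N K p.1 p.2 } → Fin l,
        ∃ (s₀ : Fin N → Fin M) (j₀ : Fin M → Fin N),
          IsConnection N M s₀ j₀ ∧
          ∃ k : Fin l,
            ∀ x : { p : (Fin N → Fin K) × (Fin K → Fin N) //
                      IsConnection N K p.1 p.2 },
              (∃ (s : Fin M → Fin K) (j : Fin K → Fin M),
                IsConnection M K s j ∧ x.1.1 = s ∘ s₀ ∧ x.1.2 = j₀ ∘ j) →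
              g x = k := by
  classical
  obtain ⟨N, hN⟩ := GR.dualRamsey (Fin l) (2*K) (2*M)
  refine ⟨N, fun g => ?_⟩
  let c : (ℕ → ℕ) → Fin l := fun r =>
    if h : ∃ p : { p : (Fin N → Fin K) × (Fin K → Fin N) // IsConnection N K p.1 p.2 },
      Decodes N K r p.1 then g h.choose else ⟨0, hl⟩
  have hc : GR.Loc (2*K) c := by
    intro r r' e h1 h2 h3
    have : Decodes N K r = Decodes N K r' := by
      funext p
      exact propext ⟨fun h => h.congr hK h1 h2 h3,
        fun h => h.congr hK h2 h1 (fun i hi => (h3 i hi).symm)⟩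
    simp only [c, this]
  have ceq : ∀ r (p : { p : (Fin N → Fin K) × (Fin K → Fin N) // IsConnection N K p.1 p.2 }),
      Decodes N K r p.1 → c r = g p := by
    intro r p h
    have hex : ∃ p : { p : (Fin N → Fin K) × (Fin K → Fin N) // IsConnection N K p.1 p.2 },
      Decodes N K r p.1 := ⟨p, h⟩
    have : hex.choose = p := Subtype.ext (hex.choose_spec.unique h)
    simp only [c, hex, dif_pos, this]
  obtain ⟨w, hw, ⟨e, he, hwF⟩, hwc⟩ := hN c hc
  choose f hf using hw
  have hfe : ∀ k < 2 * M, f k < e := fun k hk => (hf k).lt hwF hk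
  have hepos : 0 < e := lt_of_le_of_lt (Nat.zero_le _) (hfe 0 (by omega))
  have hlow : ∀ y : ℕ, (if y < e then y else 0) < e := fun y => by split_ifs <;> assumption
  have hs0 : ∀ y : ℕ, w (if y < e then y else 0) / 2 < M := fun y => by
    have := hwF.2 _ (hlow y); omega
  have hle0 : ∀ y : ℕ, (if y < e then y else 0) ≤ y := fun y => by split_ifs <;> omega
  let s₀ : Fin N → Fin M := fun y => ⟨w (if (y : ℕ) < e then y else 0) / 2, hs0 y⟩
  let j₀ : Fin M → Fin N := fun x => ⟨f (2 * x + 1), by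
    have := hfe (2 * x + 1) (by have := x.2; omega); omega⟩
  have hconn : IsConnection N M s₀ j₀ := by
    refine ⟨rigidSurj_of_first _ fun x => ?_, fun x => ?_, fun x y hy => ?_⟩
    · have h1 := hfe (2 * x) (by have := x.2; omega)
      refine ⟨⟨f (2 * x), by omega⟩, ?_, fun y hy => ?_⟩
      · ext
        simp only [s₀, h1, if_true, (hf _).1]
        omega
      · rw [Fin.lt_def] at hy ⊢
        have := (hf (2 * x)).2 _ (lt_of_le_of_lt (hle0 y) hy)
        simp only [s₀]
        omega
    · have h1 := hfe (2 * x + 1) (by have := x.2; omega)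
      ext
      simp only [s₀, j₀, h1, if_true, (hf _).1]
      omega
    · rw [Fin.le_def] at hy ⊢
      simp only [j₀] at hy
      simp only [s₀]
      rcases Nat.lt_or_eq_of_le ((hle0 y).trans hy) with h1 | h1
      · have := (hf (2 * x + 1)).2 _ h1
        omega
      · rw [h1, (hf _).1]; omega
  refine ⟨s₀, j₀, hconn, ?_⟩
  have key : ∀ x : { p : (Fin N → Fin K) × (Fin K → Fin N) // IsConnection N K p.1 p.2 },
      (∃ (s : Fin M → Fin K) (j : Fin K → Fin M),
        IsConnection M K s j ∧ x.1.1 = s ∘ s₀ ∧ x.1.2 = j₀ ∘ j) →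
      ∃ r, GR.Rig r ∧ GR.First r (2*K) (2*M) ∧ c (r ∘ w) = g x := by
    rintro x ⟨s, j, hsj, hx1, hx2⟩
    obtain ⟨r, hr, hrF, hrj, hrs⟩ := exists_code hsj
    refine ⟨r, hr, hrF, ceq _ _ ⟨e, hrF.comp hwF, fun y => ?_, fun z => ?_⟩⟩
    · rw [hx1]
      exact (hrs (w (if (y : ℕ) < e then y else 0)) (hs0 y)).symm
    · rw [hx2]
      exact (hrj z).comp (hf _)
  by_cases hex : ∃ r, GR.Rig r ∧ GR.First r (2*K) (2*M)
  · obtain ⟨r, hr, hrF⟩ := hex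
    refine ⟨c (r ∘ w), fun x hx => ?_⟩
    obtain ⟨r', hr', hrF', h⟩ := key x hx
    rw [← h]
    exact hwc r' r _ _ hr' hr hrF' hrF le_rfl le_rfl
  · refine ⟨⟨0, hl⟩, fun x hx => ?_⟩
    obtain ⟨r', hr', hrF', h⟩ := key x hx
    exact absurd ⟨r', hr', hrF'⟩ hex
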